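/- Let n ≥ 1, 0 < α < 2n, 1 < p₁, p₂ < ∞. There is a constant C depending only on n, α, p₁, p₂ such that: whenever Q is a cube with center x_Q, f₁ is supported in Q with |f₁| ≤ 2|Q|^{−1/p₁} pointwise and ∫_Q f₁ = 0, f₂ is supported in Q with |f₂| ≤ 2|Q|^{−1/p₂} pointwise, and x ∈ (2√n Q)^c, then |I_α(f₁, f₂)(x)| ≤ C |Q|^{1/p₁' + 1/p₂' + 1/n} |x − x_Q|^{−2n + α − 1}, where 1/p_i' = 1 − 1/p_i. -/

import Mathlib

open MeasureTheory Filter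
open scoped ENNReal Topology

noncomputable section

/-- Euclidean space `ℝⁿ`. -/
abbrev Rn (n : ℕ) := EuclideanSpace ℝ (Fin n)

/-- Axis-parallel closed cube with center `c` and side length `r`. -/
def cube (n : ℕ) (c : Rn n) (r : ℝ) : Set (Rn n) := {y | ∀ i, |y i - c i| ≤ r / 2}

/-- Average of `b` over a set `Q`. -/
def avg (n : ℕ) (b : Rn n → ℝ) (Q : Set (Rn n)) : ℝ :=
  (volume Q).toReal⁻¹ * ∫ x in Q, b x

/-- Mean oscillation of `b` over a set `Q`. -/
def osc (n : ℕ) (b : Rn n → ℝ) (Q : Set (Rn n)) : ℝ :=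
  (volume Q).toReal⁻¹ * ∫ x in Q, |b x - avg n b Q|

/-- The BMO seminorm `‖b‖_*`, as an extended real number (supremum of the mean
oscillations over all cubes). -/
def bmoNorm (n : ℕ) (b : Rn n → ℝ) : ℝ≥0∞ :=
  ⨆ (c : Rn n) (r : {r : ℝ // 0 < r}), ENNReal.ofReal (osc n b (cube n c r.1))

/-- `b ∈ BMO(ℝⁿ)`. -/
def MemBMO (n : ℕ) (b : Rn n → ℝ) : Prop :=
  LocallyIntegrable b volume ∧ bmoNorm n b < ⊤

/-- `b ∈ CMO(ℝⁿ)`: `b` lies in the closure of `C_c^∞(ℝⁿ)` in the BMO seminorm. -/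
def MemCMO (n : ℕ) (b : Rn n → ℝ) : Prop :=
  LocallyIntegrable b volume ∧
  ∀ ε : ℝ, 0 < ε → ∃ g : Rn n → ℝ, ContDiff ℝ (⊤ : ℕ∞) g ∧ HasCompactSupport g ∧
    bmoNorm n (fun x => b x - g x) ≤ ENNReal.ofReal ε

/-- The bilinear fractional integral operator `B_α`. -/
def Bop (n : ℕ) (α : ℝ) (f g : Rn n → ℝ) (x : Rn n) : ℝ :=
  ∫ y, f (x - y) * g (x + y) * ‖y‖ ^ (α - n)

/-- The first commutator `[b, B_α]₁`. -/
def commB (n : ℕ) (α : ℝ) (b f g : Rn n → ℝ) (x : Rn n) : ℝ :=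
  ∫ y, (b x - b y) * f y * g ((2 : ℝ) • x - y) * ‖x - y‖ ^ (α - n)

/-- The bilinear fractional integral operator `I_α`. -/
def Iop (n : ℕ) (α : ℝ) (f₁ f₂ : Rn n → ℝ) (x : Rn n) : ℝ :=
  ∫ y₁, ∫ y₂, f₁ y₁ * f₂ y₂ * (‖x - y₁‖ ^ 2 + ‖x - y₂‖ ^ 2) ^ (α / 2 - n)

/-- The iterated commutator `[Πb⃗, I_α]` with `b⃗ = (b, b)`. -/
def commI (n : ℕ) (α : ℝ) (b f₁ f₂ : Rn n → ℝ) (x : Rn n) : ℝ :=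
  ∫ y₁, ∫ y₂, (b x - b y₁) * (b x - b y₂) * f₁ y₁ * f₂ y₂ *
    (‖x - y₁‖ ^ 2 + ‖x - y₂‖ ^ 2) ^ (α / 2 - n)

/-- The Muckenhoupt class `A_p`. -/
def MemAp (n : ℕ) (p : ℝ) (w : Rn n → ℝ) : Prop :=
  ∃ C : ℝ, ∀ (c : Rn n) (r : ℝ), 0 < r →
    ((volume (cube n c r)).toReal⁻¹ * ∫ x in cube n c r, w x) *
      ((volume (cube n c r)).toReal⁻¹ * ∫ x in cube n c r, w x ^ (-(1 / (p - 1)))) ^ (p - 1) ≤ C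

/-- The bilinear weight class `A_{P,q}` with `P = (p₁, p₂)`. -/
def MemAPq (n : ℕ) (p₁ p₂ q : ℝ) (w₁ w₂ : Rn n → ℝ) : Prop :=
  ∃ C : ℝ, ∀ (c : Rn n) (r : ℝ), 0 < r →
    ((volume (cube n c r)).toReal⁻¹ * ∫ x in cube n c r, w₁ x ^ q * w₂ x ^ q) *
      ((volume (cube n c r)).toReal⁻¹ *
          ∫ x in cube n c r, w₁ x ^ (-(1 - 1 / p₁)⁻¹)) ^ (q * (1 - 1 / p₁)) *
      ((volume (cube n c r)).toReal⁻¹ *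
          ∫ x in cube n c r, w₂ x ^ (-(1 - 1 / p₂)⁻¹)) ^ (q * (1 - 1 / p₂)) ≤ C

theorem cube_eq_preimage (n : ℕ) (c : Rn n) (r : ℝ) :
    cube n c r = (MeasurableEquiv.toLp 2 (Fin n → ℝ)).symm ⁻¹'
      Set.univ.pi (fun i => Set.Icc (c i - r / 2) (c i + r / 2)) := by
  ext y
  simp only [cube, Set.mem_ofPred_eq, Set.mem_preimage, Set.mem_univ_pi, Set.mem_Icc]
  refine forall_congr' fun i => ?_
  rw [abs_le]
  change _ ↔ c i - r / 2 ≤ y i ∧ y i ≤ c i + r / 2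
  constructor <;> rintro ⟨h₁, h₂⟩ <;> constructor <;> linarith

theorem measurableSet_cube (n : ℕ) (c : Rn n) (r : ℝ) : MeasurableSet (cube n c r) := by
  rw [cube_eq_preimage]
  exact (MeasurableEquiv.toLp 2 (Fin n → ℝ)).symm.measurable
    (MeasurableSet.univ_pi fun _ => measurableSet_Icc)

theorem volume_cube (n : ℕ) (c : Rn n) (r : ℝ) :
    volume (cube n c r) = ENNReal.ofReal r ^ n := by
  rw [cube_eq_preimage,
    (EuclideanSpace.volume_preserving_symm_measurableEquiv_toLp (Fin n)).measure_preimage_equiv,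
    volume_pi_pi]
  simp [Real.volume_Icc]

theorem volume_cube_toReal (n : ℕ) (c : Rn n) {r : ℝ} (hr : 0 ≤ r) :
    (volume (cube n c r)).toReal = r ^ n := by
  rw [volume_cube, ENNReal.toReal_pow, ENNReal.toReal_ofReal hr]

theorem volume_cube_lt_top (n : ℕ) (c : Rn n) (r : ℝ) : volume (cube n c r) < ⊤ := by
  rw [volume_cube]
  exact ENNReal.pow_lt_top ENNReal.ofReal_lt_top

theorem norm_sub_center_le {n : ℕ} {c y : Rn n} {r : ℝ} (hr : 0 ≤ r) (hy : y ∈ cube n c r) :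
    ‖y - c‖ ≤ √n * r / 2 := by
  rw [EuclideanSpace.norm_eq]
  refine Real.sqrt_le_iff.2 ⟨by positivity, ?_⟩
  calc ∑ i, ‖(y - c) i‖ ^ 2 ≤ ∑ _i : Fin n, (r / 2) ^ 2 := by
        refine Finset.sum_le_sum fun i _ => ?_
        exact pow_le_pow_left₀ (norm_nonneg _) (hy i) 2
    _ = (√n * r / 2) ^ 2 := by
        rw [Finset.sum_const, Finset.card_univ, Fintype.card_fin, nsmul_eq_mul,
          mul_div_assoc, mul_pow, Real.sq_sqrt (Nat.cast_nonneg n)]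

theorem lt_norm_sub_center {n : ℕ} {c x : Rn n} {r : ℝ} (hx : x ∉ cube n c (2 * r)) :
    r < ‖x - c‖ := by
  simp only [cube, Set.mem_ofPred_eq, not_forall, not_le] at hx
  obtain ⟨i, hi⟩ := hx
  calc r = 2 * r / 2 := by ring
    _ < |x i - c i| := hi
    _ = ‖(x - c) i‖ := rfl
    _ ≤ ‖x - c‖ := PiLp.norm_apply_le _ i

/-- Lipschitz estimate for a negative power away from the origin. -/
theorem abs_rpow_sub_rpow_le {s m a b : ℝ} (hs : 0 < s) (hm : 0 < m) (ha : m ≤ a) (hb : m ≤ b) :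
    |a ^ (-s) - b ^ (-s)| ≤ s * m ^ (-s - 1) * |a - b| := by
  have hderiv : ∀ t ∈ Set.Ici m,
      HasDerivWithinAt (fun t : ℝ => t ^ (-s)) (-s * t ^ (-s - 1)) (Set.Ici m) t := fun t ht =>
    (Real.hasDerivAt_rpow_const (Or.inl (hm.trans_le ht).ne')).hasDerivWithinAt
  refine (convex_Ici m).norm_image_sub_le_of_norm_hasDerivWithin_le hderiv (fun t ht => ?_) hb ha
  have ht0 : 0 < t := hm.trans_le ht
  rw [norm_mul, norm_neg, Real.norm_of_nonneg hs.le,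
    Real.norm_of_nonneg (Real.rpow_nonneg ht0.le _)]
  exact mul_le_mul_of_nonneg_left
    (Real.rpow_le_rpow_of_nonpos hm ht (by linarith)) hs.le

/-- Regularity of the kernel of `Iop` in its first variable. -/
theorem kernel_sub_le {E : Type*} [SeminormedAddCommGroup E] {s d : ℝ} {x c y₁ y₂ : E}
    (hs : 0 < s) (hxc : 0 < ‖x - c‖) (hd : d ≤ ‖x - c‖ / 2)
    (hy₁ : ‖y₁ - c‖ ≤ d) :
    |(‖x - y₁‖ ^ 2 + ‖x - y₂‖ ^ 2) ^ (-s) - (‖x - c‖ ^ 2 + ‖x - y₂‖ ^ 2) ^ (-s)| ≤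
      5 / 2 * s * 4 ^ (s + 1) * d * ‖x - c‖ ^ (-(2 * s) - 1) := by
  set D := ‖x - c‖ with hD
  have h₁ : |‖x - y₁‖ - D| ≤ d := by
    refine (abs_norm_sub_norm_le (x - y₁) (x - c)).trans ?_
    rwa [sub_sub_sub_cancel_left, norm_sub_rev]
  obtain ⟨hl, hu⟩ := abs_le.1 h₁
  have hm : (D / 2) ^ 2 ≤ ‖x - y₁‖ ^ 2 := pow_le_pow_left₀ (by positivity) (by linarith) 2
  have hm' : (D / 2) ^ 2 ≤ D ^ 2 := pow_le_pow_left₀ (by positivity) (by linarith) 2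
  have hd0 : 0 ≤ d := (norm_nonneg _).trans hy₁
  calc _ ≤ s * ((D / 2) ^ 2) ^ (-s - 1) *
        |(‖x - y₁‖ ^ 2 + ‖x - y₂‖ ^ 2) - (D ^ 2 + ‖x - y₂‖ ^ 2)| :=
        abs_rpow_sub_rpow_le hs (by positivity)
          (le_add_of_le_of_nonneg hm (by positivity)) (le_add_of_le_of_nonneg hm' (by positivity))
    _ ≤ s * ((D / 2) ^ 2) ^ (-s - 1) * (d * (5 / 2 * D)) := by
        refine mul_le_mul_of_nonneg_left ?_ (by positivity)
        rw [show (‖x - y₁‖ ^ 2 + ‖x - y₂‖ ^ 2) - (D ^ 2 + ‖x - y₂‖ ^ 2) =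
          (‖x - y₁‖ - D) * (‖x - y₁‖ + D) by ring, abs_mul,
          abs_of_nonneg (by positivity : 0 ≤ ‖x - y₁‖ + D)]
        exact mul_le_mul h₁ (by linarith) (by positivity) hd0
    _ = _ := by
        have e : ((D / 2) ^ 2) ^ (-s - 1) = 4 ^ (s + 1) * D ^ (-(2 * s) - 2) := by
          rw [div_pow, Real.div_rpow (by positivity) (by positivity), ← Real.rpow_natCast D 2,
            ← Real.rpow_mul hxc.le, div_eq_inv_mul, ← Real.rpow_neg (by positivity)]
          norm_num
          ring_nf
        have e' : D ^ (-(2 * s) - 1) = D ^ (-(2 * s) - 2) * D := by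
          rw [← Real.rpow_add_one hxc.ne']
          ring_nf
        rw [e, e']
        ring

theorem norm_integral_le_of_support_subset {X : Type*} [MeasurableSpace X] {μ : Measure X}
    {S : Set X} {f : X → ℝ} {M : ℝ} (hS : μ S < ⊤) (hf : ∀ y, y ∉ S → f y = 0)
    (hM : ∀ y ∈ S, |f y| ≤ M) : |∫ y, f y ∂μ| ≤ M * (μ S).toReal := by
  rw [← setIntegral_eq_integral_of_forall_compl_eq_zero hf]
  exact norm_setIntegral_le_of_norm_le_const (f := f) hS hM

theorem integrable_of_support_subset {X : Type*} [MeasurableSpace X] {μ : Measure X}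
    {S : Set X} {f : X → ℝ} {M : ℝ} (hS : μ S < ⊤) (hfm : Measurable f)
    (hf : ∀ y, y ∉ S → f y = 0) (hM : ∀ y, |f y| ≤ M) : Integrable f μ := by
  have h : IntegrableOn f S μ := Measure.integrableOn_of_bounded hS.ne
    hfm.aestronglyMeasurable (Eventually.of_forall hM)
  exact h.integrable_of_forall_notMem_eq_zero hf

/-- Cancellation estimate: a mean zero function paired with an arbitrary function is controlled
by the oscillation of the latter about any of its values. -/
theorem abs_integral_mul_le_of_integral_eq_zero {X : Type*} [MeasurableSpace X] {μ : Measure X}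
    {S : Set X} {f G : X → ℝ} {M N : ℝ} (a : ℝ) (hS : μ S < ⊤) (hfi : Integrable f μ)
    (hf : ∀ y, y ∉ S → f y = 0) (hM : ∀ y, |f y| ≤ M) (h0 : ∫ y, f y ∂μ = 0)
    (hM0 : 0 ≤ M) (hN0 : 0 ≤ N) (hG : ∀ y ∈ S, |G y - a| ≤ N) :
    |∫ y, f y * G y ∂μ| ≤ M * N * (μ S).toReal := by
  by_cases hi : Integrable (fun y => f y * G y) μ
  · have e : ∫ y, f y * G y ∂μ = ∫ y, f y * (G y - a) ∂μ := by
      simp_rw [mul_sub]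
      rw [integral_sub hi (hfi.mul_const a), integral_mul_const, h0, zero_mul, sub_zero]
    rw [e]
    refine norm_integral_le_of_support_subset hS (fun y hy => by rw [hf y hy, zero_mul]) ?_
    intro y hy
    rw [abs_mul]
    exact mul_le_mul (hM y) (hG y hy) (abs_nonneg _) hM0
  · rw [integral_undef hi, abs_zero]
    positivity

theorem integrable_mul_kernel {n : ℕ} {S : Set (Rn n)} {f : Rn n → ℝ} {M s m : ℝ} {x z : Rn n}
    (hS : volume S < ⊤) (hfm : Measurable f) (hf : ∀ y, y ∉ S → f y = 0) (hM : ∀ y, |f y| ≤ M)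
    (hs : 0 < s) (hm : 0 < m) (hz : m ≤ ‖x - z‖) :
    Integrable (fun y => f y * (‖x - z‖ ^ 2 + ‖x - y‖ ^ 2) ^ (-s)) volume := by
  refine integrable_of_support_subset (M := M * (m ^ 2) ^ (-s)) hS (by fun_prop)
    (fun y hy => by rw [hf y hy, zero_mul]) fun y => ?_
  rw [abs_mul]
  refine mul_le_mul (hM y) ?_ (abs_nonneg _) ((abs_nonneg _).trans (hM y))
  rw [abs_of_nonneg (by positivity)]
  refine Real.rpow_le_rpow_of_nonpos (by positivity) ?_ (by linarith)
  exact le_add_of_le_of_nonneg (pow_le_pow_left₀ hm.le hz 2) (by positivity)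

/-- pointwise upper bound `|I_α(f₁, f₂)(x)| ≲ |Q|^{1/p₁'+1/p₂'+1/n}
|x - x_Q|^{-2n+α-1}` for `x ∈ (2√n Q)^c`, when `f₁` has mean zero. -/
theorem statement13 (n : ℕ) (hn : 1 ≤ n) (α p₁ p₂ : ℝ)
    (hα : 0 < α) (hαn : α < 2 * n) (hp₁ : 1 < p₁) (hp₂ : 1 < p₂) :
    ∃ C : ℝ, ∀ (c : Rn n) (r : ℝ), 0 < r →
      ∀ f₁ f₂ : Rn n → ℝ, Measurable f₁ → Measurable f₂ →
      (∀ y, y ∉ cube n c r → f₁ y = 0) →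
      (∀ y, |f₁ y| ≤ 2 * (volume (cube n c r)).toReal ^ (-(1 / p₁))) →
      (∫ y in cube n c r, f₁ y) = 0 →
      (∀ y, y ∉ cube n c r → f₂ y = 0) →
      (∀ y, |f₂ y| ≤ 2 * (volume (cube n c r)).toReal ^ (-(1 / p₂))) →
      ∀ x : Rn n, x ∉ cube n c (2 * Real.sqrt n * r) →
        |Iop n α f₁ f₂ x| ≤
          C * (volume (cube n c r)).toReal ^ ((1 - 1 / p₁) + (1 - 1 / p₂) + 1 / n) *
            ‖x - c‖ ^ (-(2 * n) + α - 1) := by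
  set s : ℝ := n - α / 2 with hs_def
  have hs : 0 < s := by simp only [hs_def]; linarith
  have hn0 : (0 : ℝ) < n := by exact_mod_cast hn
  refine ⟨5 * s * 4 ^ (s + 1) * √n, ?_⟩
  intro c r hr f₁ f₂ hf₁ hf₂ hs₁ hb₁ h0 hs₂ hb₂ x hx
  have hD : √n * r < ‖x - c‖ := lt_norm_sub_center (by rwa [← mul_assoc])
  have hV : (volume (cube n c r)).toReal = r ^ n := volume_cube_toReal n c hr.le
  have hfin := volume_cube_lt_top n c r
  set V := (volume (cube n c r)).toReal with hV_def
  have hV0 : 0 < V := by rw [hV]; positivity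
  have hD0 : 0 < ‖x - c‖ := lt_of_le_of_lt (by positivity) hD
  set D := ‖x - c‖ with hD_def
  set d := √n * r / 2 with hd
  have hdD : d ≤ D / 2 := by linarith
  set N := 5 / 2 * s * 4 ^ (s + 1) * d * D ^ (-(2 * s) - 1) with hN
  have hN0 : 0 ≤ N := by positivity
  have hint : ∀ z : Rn n, D / 2 ≤ ‖x - z‖ →
      Integrable (fun y => f₂ y * (‖x - z‖ ^ 2 + ‖x - y‖ ^ 2) ^ (-s)) volume := fun z hz =>
    integrable_mul_kernel hfin hf₂ hs₂ hb₂ hs (half_pos hD0) hz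
  have hG : ∀ y₁ ∈ cube n c r,
      |(∫ y, f₂ y * (‖x - y₁‖ ^ 2 + ‖x - y‖ ^ 2) ^ (-s)) -
        ∫ y, f₂ y * (‖x - c‖ ^ 2 + ‖x - y‖ ^ 2) ^ (-s)| ≤ 2 * V ^ (-(1 / p₂)) * N * V := by
    intro y₁ hy₁
    have hy := norm_sub_center_le hr.le hy₁
    have htri : D ≤ ‖x - y₁‖ + ‖y₁ - c‖ := norm_sub_le_norm_sub_add_norm_sub x y₁ c
    rw [← integral_sub (hint y₁ (by linarith)) (hint c (by linarith))]
    simp_rw [← mul_sub]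
    refine norm_integral_le_of_support_subset hfin
      (fun y hy => by rw [hs₂ y hy, zero_mul]) fun y _ => ?_
    rw [abs_mul]
    exact mul_le_mul (hb₂ y) (kernel_sub_le hs hD0 hdD hy) (abs_nonneg _) (by positivity)
  have hI : Iop n α f₁ f₂ x =
      ∫ y₁, f₁ y₁ * ∫ y, f₂ y * (‖x - y₁‖ ^ 2 + ‖x - y‖ ^ 2) ^ (-s) := by
    simp only [Iop, mul_assoc, integral_const_mul, hs_def, neg_sub]
  rw [setIntegral_eq_integral_of_forall_compl_eq_zero hs₁] at h0
  rw [hI]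
  refine (abs_integral_mul_le_of_integral_eq_zero _ hfin
    (integrable_of_support_subset hfin hf₁ hs₁ hb₁) hs₁ hb₁ h0 (by positivity)
    (by positivity) hG).trans (le_of_eq ?_)
  have hroot : V ^ (1 / (n : ℝ)) = r := by
    rw [hV, one_div, Real.pow_rpow_inv_natCast hr.le (by omega)]
  have hexp : -(2 * s) - 1 = -(2 * n) + α - 1 := by rw [hs_def]; ring
  rw [Real.rpow_add hV0, Real.rpow_add hV0, hroot, sub_eq_add_neg 1, sub_eq_add_neg 1,
    Real.rpow_add hV0, Real.rpow_add hV0, Real.rpow_one, ← hV_def, hN, hexp, hd]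
  ring
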